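/- arXiv:2110.11255 — 2 statements merged into one kernel-verified Lean document; each statement's English description precedes it below -/
import Mathlib

section
/- Let χ : (0,∞) → ℝ³ be a continuous bounded function with nonnegative components such that supp χ = [λmin, λmax] for some 0 ≤ λmin < λmax < ∞ and χ(λ) ≠ 0 for all λ ∈ (λmin, λmax), and suppose the normalized response η(λ) := χ(λ)/(χ₁(λ)+χ₂(λ)+χ₃(λ)) extends continuously to [λmin, λmax]. Define the color triangle T := { ∫_{(0,∞)} χ dμ : μ a finite Borel measure on (0,∞) with ∫_{(0,∞)} (χ₁+χ₂+χ₃) dμ = 1 }. Then int conv(η([λmin, λmax])) ⊆ T ⊆ conv(η([λmin, λmax])), where the interior is taken relative to the affine hyperplane A = {x ∈ ℝ³ : x₁ + x₂ + x₃ = 1}. -/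
open MeasureTheory Set

noncomputable section

abbrev E3 := EuclideanSpace ℝ (Fin 3)

/-- The affine hyperplane `A = {x ∈ ℝ³ : x₁ + x₂ + x₃ = 1}`. -/
def planeA : Set E3 := {x | x 0 + x 1 + x 2 = 1}

/-- Interior relative to the affine hyperplane `A` (for subsets of `A`). -/
def intA (s : Set E3) : Set E3 :=
  {x | x ∈ planeA ∧ ∃ U : Set E3, IsOpen U ∧ x ∈ U ∧ U ∩ planeA ⊆ s}

lemma ct_interior_closure (D : Set E3) (hD : Convex ℝ D) : interior (closure D) ⊆ D := by
  intro x hx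
  have h1 : affineSpan ℝ (closure D) = ⊤ := by
    apply (Convex.interior_nonempty_iff_affineSpan_eq_top hD.closure).1 ⟨x, hx⟩
  have h2 : closure D ⊆ (affineSpan ℝ D : Set E3) := by
    apply closure_minimal (subset_affineSpan ℝ D)
    exact AffineSubspace.closed_of_finiteDimensional _
  have h3 : affineSpan ℝ D = ⊤ := by
    rw [eq_top_iff, ← h1]
    exact affineSpan_le.2 h2
  have h4 : (interior D).Nonempty := (Convex.interior_nonempty_iff_affineSpan_eq_top hD).2 h3
  rw [hD.interior_closure_eq_interior_of_nonempty_interior h4] at hx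
  exact interior_subset hx

/-- The vector `(1,1,1)`. -/
def ctOne : E3 := !₂[1, 1, 1]

/-- Affine-projection onto the plane. -/
def ctP (x : E3) : E3 := x - ((x 0 + x 1 + x 2 - 1) / 3) • ctOne

lemma ctP_add (x : E3) (hx : x ∈ planeA) (t : ℝ) : ctP (x + t • ctOne) = x := by
  have hx' : x 0 + x 1 + x 2 = 1 := hx
  ext i
  fin_cases i <;> simp [ctP, ctOne] <;> linarith

lemma ctP_mem (x : E3) : ctP x ∈ planeA := by
  simp [ctP, ctOne, planeA]; ring

lemma ctP_cont : Continuous ctP := by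
  unfold ctP
  fun_prop

lemma ctP_comb (x y : E3) (a b : ℝ) (hab : a + b = 1) :
    ctP (a • x + b • y) = a • ctP x + b • ctP y := by
  have hb : b = 1 - a := by linarith
  subst hb
  ext i
  fin_cases i <;> simp [ctP, ctOne] <;> ring

lemma ct_intA (C : Set E3) (hC : Convex ℝ C) (hCA : C ⊆ planeA) : intA (closure C) ⊆ C := by
  rintro x ⟨hxA, U, hU, hxU, hUs⟩
  have hPx : ctP x = x := by simpa using ctP_add x hxA 0
  have hD : Convex ℝ (ctP ⁻¹' C) := by
    intro y hy z hz a b ha hb hab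
    change ctP _ ∈ C
    rw [ctP_comb y z a b hab]
    exact hC hy hz ha hb hab
  have key : x ∈ interior (closure (ctP ⁻¹' C)) := by
    rw [mem_interior]
    refine ⟨ctP ⁻¹' U, ?_, hU.preimage ctP_cont, by simpa [hPx] using hxU⟩
    intro y hy
    have hy2 : ctP y ∈ closure C := hUs ⟨hy, ctP_mem y⟩
    have hcont : Continuous (fun z : E3 => z + ((y 0 + y 1 + y 2 - 1) / 3) • ctOne) := by fun_prop
    have hm : MapsTo (fun z : E3 => z + ((y 0 + y 1 + y 2 - 1) / 3) • ctOne) C (ctP ⁻¹' C) := by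
      intro z hz
      change ctP _ ∈ C
      rw [ctP_add z (hCA hz)]
      exact hz
    have := hm.closure hcont hy2
    simpa [ctP] using this
  have := ct_interior_closure _ hD key
  simpa [hPx] using this

lemma ct_planeA_convex : Convex ℝ planeA := by
  intro y hy z hz a b ha hb hab
  have hy' : y 0 + y 1 + y 2 = 1 := hy
  have hz' : z 0 + z 1 + z 2 = 1 := hz
  change (a • y + b • z) 0 + (a • y + b • z) 1 + (a • y + b • z) 2 = 1
  simp only [PiLp.add_apply, PiLp.smul_apply, smul_eq_mul]
  linear_combination a * hy' + b * hz' + hab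

lemma ct_integrable (χ : ℝ → E3)
    (hχcont : ContinuousOn χ (Ioi 0))
    (hχbdd : ∃ M : ℝ, ∀ lam ∈ Ioi (0:ℝ), ‖χ lam‖ ≤ M) (mu : Measure ℝ) (h : IsFiniteMeasure mu) :
    IntegrableOn χ (Ioi 0) mu := by
  obtain ⟨M, hM⟩ := hχbdd
  have h1 : AEStronglyMeasurable χ (mu.restrict (Ioi 0)) :=
    hχcont.aestronglyMeasurable measurableSet_Ioi
  refine Integrable.of_bound h1 M ?_
  exact (ae_restrict_iff' measurableSet_Ioi).2 (Filter.Eventually.of_forall hM)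

lemma ct_dirac (l : ℝ) (hl : l ∈ Ioi (0:ℝ)) :
    (Measure.dirac l).restrict (Ioi (0:ℝ)) = Measure.dirac l := by
  classical
  rw [restrict_dirac' measurableSet_Ioi, if_pos hl]

lemma ct_compact_hull (K : Set E3) (hK : IsCompact K) : IsCompact (convexHull ℝ K) := by
  have h1 : IsCompact ((stdSimplex ℝ (Fin 4)) ×ˢ (Set.univ.pi fun _ : Fin 4 => K)) :=
    (isCompact_stdSimplex ℝ (Fin 4)).prod (isCompact_univ_pi fun _ => hK)
  have h2 : Continuous (fun p : (Fin 4 → ℝ) × (Fin 4 → E3) => ∑ i, p.1 i • p.2 i) := by fun_prop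
  convert h1.image h2 using 1
  ext x
  constructor
  · intro hx
    obtain ⟨ι, _, z, w, hz, hai, hw, hw1, hwx⟩ := eq_pos_convex_span_of_mem_convexHull hx
    obtain ⟨z0, hz0⟩ : K.Nonempty := (convexHull_nonempty_iff (𝕜 := ℝ)).1 ⟨x, hx⟩
    have hcard : Fintype.card ι ≤ Fintype.card (Fin 4) := by
      have h3 := hai.card_le_finrank_succ
      have h4 := Submodule.finrank_le (vectorSpan ℝ (Set.range z))
      have h5 : Module.finrank ℝ E3 = 3 := by simp [E3]
      simp only [Fintype.card_fin]
      omega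
    obtain ⟨e⟩ := Function.Embedding.nonempty_of_card_le hcard
    have hwe : ∀ i, Function.extend e w 0 (e i) = w i := fun i => e.injective.extend_apply w 0 i
    have hze : ∀ i, Function.extend e z (fun _ => z0) (e i) = z i :=
      fun i => e.injective.extend_apply z _ i
    have hw0 : ∀ j, j ∉ Set.range e → Function.extend e w 0 j = 0 := by
      intro j hj
      rw [Function.extend_apply' _ _ _ (by simpa using hj)]
      rfl
    refine ⟨(Function.extend e w 0, Function.extend e z (fun _ => z0)), ⟨⟨?_, ?_⟩, ?_⟩, ?_⟩
    · intro j
      by_cases hj : j ∈ Set.range e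
      · obtain ⟨i, rfl⟩ := hj
        exact (hw i).le.trans (hwe i).ge
      · exact (hw0 j hj).ge
    · rw [← hw1]
      symm
      apply Finset.sum_of_injOn e e.injective.injOn (fun _ _ => by simp)
      · intro j _ hj
        exact hw0 j (by simpa using hj)
      · intro i _
        exact (hwe i).symm
    · intro j _
      by_cases hj : j ∈ Set.range e
      · obtain ⟨i, rfl⟩ := hj
        change Function.extend e z (fun _ => z0) (e i) ∈ K
        rw [hze]
        exact hz ⟨i, rfl⟩
      · change Function.extend e z (fun _ => z0) j ∈ K
        rw [Function.extend_apply' _ _ _ (by simpa using hj)]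
        exact hz0
    · rw [← hwx]
      symm
      apply Finset.sum_of_injOn e e.injective.injOn (fun _ _ => by simp)
      · intro j _ hj
        have := hw0 j (by simpa using hj)
        simp [this]
      · intro i _
        simp only [hwe, hze]
  · rintro ⟨⟨w, z⟩, ⟨⟨hw0, hw1⟩, hz⟩, rfl⟩
    exact (convex_convexHull ℝ K).sum_mem (fun i _ => hw0 i) hw1
      (fun i _ => subset_convexHull ℝ K (hz i trivial))

/-- `int conv(η([λmin, λmax])) ⊆ T ⊆ conv(η([λmin, λmax]))`, where `T` is the
color triangle, i.e. the set of colors of finite Borel measures on `(0,∞)` normalized so that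
`∫ (χ₁+χ₂+χ₃) dμ = 1`, and the interior is relative to the hyperplane `A`. -/
theorem color_triangle_between_hull_and_its_interior
    (lmin lmax : ℝ) (hlmin : 0 ≤ lmin) (hlt : lmin < lmax)
    (χ : ℝ → E3)
    (hχcont : ContinuousOn χ (Ioi 0))
    (hχbdd : ∃ M : ℝ, ∀ lam ∈ Ioi (0:ℝ), ‖χ lam‖ ≤ M)
    (hχnonneg : ∀ lam ∈ Ioi (0:ℝ), ∀ i, 0 ≤ χ lam i)
    (hχzero : ∀ lam ∈ Ioi (0:ℝ), lam ∉ Icc lmin lmax → χ lam = 0)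
    (hχne : ∀ lam ∈ Ioo lmin lmax, χ lam ≠ 0)
    (η : ℝ → E3)
    (hηcont : ContinuousOn η (Icc lmin lmax))
    (hηdef : ∀ lam ∈ Ioo lmin lmax, η lam = (χ lam 0 + χ lam 1 + χ lam 2)⁻¹ • χ lam) :
    intA (convexHull ℝ (η '' Icc lmin lmax)) ⊆
      {c : E3 | ∃ mu : Measure ℝ, IsFiniteMeasure mu ∧
        (∫ lam in Ioi (0:ℝ), (χ lam 0 + χ lam 1 + χ lam 2) ∂mu) = 1 ∧
        c = ∫ lam in Ioi (0:ℝ), χ lam ∂mu} ∧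
    {c : E3 | ∃ mu : Measure ℝ, IsFiniteMeasure mu ∧
        (∫ lam in Ioi (0:ℝ), (χ lam 0 + χ lam 1 + χ lam 2) ∂mu) = 1 ∧
        c = ∫ lam in Ioi (0:ℝ), χ lam ∂mu} ⊆
      convexHull ℝ (η '' Icc lmin lmax) := by
  have hmem : ∀ lam ∈ Ioo lmin lmax, lam ∈ Ioi (0:ℝ) := fun l hl => lt_of_le_of_lt hlmin hl.1
  have hpos : ∀ lam ∈ Ioo lmin lmax, 0 < χ lam 0 + χ lam 1 + χ lam 2 := by
    intro l hl
    have h := hχnonneg l (hmem l hl)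
    by_contra hn
    apply hχne l hl
    have h0 := h 0
    have h1 := h 1
    have h2 := h 2
    ext i
    fin_cases i <;> simp <;> linarith
  have hzero : ∀ lam ∈ Ioi (0:ℝ), lam ∉ Ioo lmin lmax → χ lam = 0 := by
    intro l hl hn
    by_cases hI : l ∈ Icc lmin lmax
    · have hc : ContinuousAt χ l := hχcont.continuousAt (Ioi_mem_nhds hl)
      have hor : l = lmin ∨ l = lmax := by
        by_contra hne
        push Not at hne
        exact hn ⟨lt_of_le_of_ne hI.1 (Ne.symm hne.1), lt_of_le_of_ne hI.2 hne.2⟩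
      rcases hor with h | h
      · have h1 : Filter.Tendsto χ (nhdsWithin l (Iio l)) (nhds (χ l)) := hc.mono_left nhdsWithin_le_nhds
        have h2 : Filter.Tendsto χ (nhdsWithin l (Iio l)) (nhds 0) := by
          apply tendsto_const_nhds.congr'
          filter_upwards [self_mem_nhdsWithin, nhdsWithin_le_nhds (Ioi_mem_nhds hl)] with x hx hx0
          exact (hχzero x hx0 (fun hh => by have := hh.1; have : x < l := hx; linarith)).symm
        exact tendsto_nhds_unique h1 h2
      · have h1 : Filter.Tendsto χ (nhdsWithin l (Ioi l)) (nhds (χ l)) := hc.mono_left nhdsWithin_le_nhds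
        have h2 : Filter.Tendsto χ (nhdsWithin l (Ioi l)) (nhds 0) := by
          apply tendsto_const_nhds.congr'
          filter_upwards [self_mem_nhdsWithin, nhdsWithin_le_nhds (Ioi_mem_nhds hl)] with x hx hx0
          exact (hχzero x hx0 (fun hh => by have := hh.2; have : l < x := hx; linarith)).symm
        exact tendsto_nhds_unique h1 h2
    · exact hχzero l hl hI
  have hint : ∀ mu : Measure ℝ, IsFiniteMeasure mu → IntegrableOn χ (Ioi 0) mu :=
    fun mu h => ct_integrable χ hχcont hχbdd mu h
  let S : E3 →L[ℝ] ℝ := EuclideanSpace.proj 0 + EuclideanSpace.proj 1 + EuclideanSpace.proj 2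
  have hS : ∀ x : E3, S x = x 0 + x 1 + x 2 := fun x => by simp [S]
  have hints : ∀ mu : Measure ℝ, IsFiniteMeasure mu →
      IntegrableOn (fun lam => χ lam 0 + χ lam 1 + χ lam 2) (Ioi 0) mu := by
    intro mu h
    have := S.integrable_comp (hint mu h)
    simp only [hS] at this
    exact this
  constructor
  · set C := convexHull ℝ (η '' Ioo lmin lmax) with hC
    have hCA : C ⊆ planeA := by
      apply convexHull_min _ ct_planeA_convex
      rintro _ ⟨l, hl, rfl⟩
      rw [hηdef l hl]
      have := (hpos l hl).ne'
      change ((χ l 0 + χ l 1 + χ l 2)⁻¹ • χ l) 0 + ((χ l 0 + χ l 1 + χ l 2)⁻¹ • χ l) 1 +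
        ((χ l 0 + χ l 1 + χ l 2)⁻¹ • χ l) 2 = 1
      simp only [PiLp.smul_apply, smul_eq_mul]
      rw [← mul_add, ← mul_add, inv_mul_cancel₀ this]
    have hsub : convexHull ℝ (η '' Icc lmin lmax) ⊆ closure C := by
      apply convexHull_min _ (convex_convexHull ℝ _).closure
      rw [← closure_Ioo hlt.ne] at hηcont ⊢
      exact hηcont.image_closure.trans (closure_mono (subset_convexHull ℝ _))
    have h1 : intA (convexHull ℝ (η '' Icc lmin lmax)) ⊆ C := by
      rintro x ⟨hxA, U, hU, hxU, hUs⟩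
      exact ct_intA C (convex_convexHull ℝ _) hCA ⟨hxA, U, hU, hxU, hUs.trans hsub⟩
    refine h1.trans (convexHull_min ?_ ?_)
    · rintro _ ⟨l, hl, rfl⟩
      have hp := hpos l hl
      refine ⟨ENNReal.ofReal (χ l 0 + χ l 1 + χ l 2)⁻¹ • Measure.dirac l, ?_, ?_, ?_⟩
      · exact Measure.smul_finite _ ENNReal.ofReal_ne_top
      · rw [Measure.restrict_smul, integral_smul_measure, ct_dirac l (hmem l hl), integral_dirac, ENNReal.toReal_ofReal (by positivity), smul_eq_mul,
          inv_mul_cancel₀ hp.ne']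
      · rw [Measure.restrict_smul, integral_smul_measure, ct_dirac l (hmem l hl), integral_dirac, ENNReal.toReal_ofReal (by positivity), hηdef l hl]
    · rintro x ⟨m1, f1, n1, rfl⟩ y ⟨m2, f2, n2, rfl⟩ a b ha hb hab
      have g1 : IsFiniteMeasure (ENNReal.ofReal a • m1) := Measure.smul_finite _ ENNReal.ofReal_ne_top
      have g2 : IsFiniteMeasure (ENNReal.ofReal b • m2) := Measure.smul_finite _ ENNReal.ofReal_ne_top
      refine ⟨ENNReal.ofReal a • m1 + ENNReal.ofReal b • m2, inferInstance, ?_, ?_⟩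
      · rw [Measure.restrict_add, integral_add_measure (hints _ g1) (hints _ g2),
          Measure.restrict_smul, Measure.restrict_smul, integral_smul_measure,
          integral_smul_measure, n1, n2, ENNReal.toReal_ofReal ha, ENNReal.toReal_ofReal hb]
        simpa using hab
      · rw [Measure.restrict_add, integral_add_measure (hint _ g1) (hint _ g2),
          Measure.restrict_smul, Measure.restrict_smul, integral_smul_measure,
          integral_smul_measure, ENNReal.toReal_ofReal ha, ENNReal.toReal_ofReal hb]
  · rintro c ⟨mu, hmu, hn, rfl⟩
    by_contra hc
    have hcl : IsClosed (convexHull ℝ (η '' Icc lmin lmax)) :=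
      (ct_compact_hull _ (isCompact_Icc.image_of_continuousOn hηcont)).isClosed
    obtain ⟨f, u, hfu, huc⟩ := geometric_hahn_banach_closed_point (convex_convexHull ℝ _) hcl hc
    rw [← f.integral_comp_comm (hint mu hmu)] at huc
    have hle : ∫ lam in Ioi (0:ℝ), f (χ lam) ∂mu ≤
        ∫ lam in Ioi (0:ℝ), u * (χ lam 0 + χ lam 1 + χ lam 2) ∂mu := by
      apply setIntegral_mono_on (f.integrable_comp (hint mu hmu)) ((hints mu hmu).const_mul u)
        measurableSet_Ioi
      intro l hl
      by_cases hI : l ∈ Ioo lmin lmax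
      · have hp := hpos l hI
        have := hfu (η l) (subset_convexHull ℝ _ ⟨l, Ioo_subset_Icc_self hI, rfl⟩)
        rw [hηdef l hI, map_smul, smul_eq_mul, inv_mul_eq_div, div_lt_iff₀ hp] at this
        exact this.le
      · simp [hzero l hl hI]
    rw [integral_const_mul, hn] at hle
    linarith
end
end

section
/- Let Λ be a nonempty set and let L ⊆ (Λ → ℝ) be a linear subspace of finite dimension k ≥ 1 that is closed under pointwise multiplication. Then every f ∈ L attains at most k distinct nonzero values, i.e. the set f(Λ) ∖ {0} has cardinality at most k. -/
open Set

/-- a `k`-dimensional linear subspace of functions `Λ → ℝ` closed under pointwise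
multiplication contains only functions attaining at most `k` distinct nonzero values. -/
theorem mult_closed_subspace_functions_take_few_values
    {Λ : Type*} [Nonempty Λ] (L : Submodule ℝ (Λ → ℝ)) (k : ℕ) (hk : 1 ≤ k)
    (hfd : FiniteDimensional ℝ L)
    (hrank : Module.finrank ℝ L = k)
    (hmul : ∀ f ∈ L, ∀ g ∈ L, f * g ∈ L) :
    ∀ f ∈ L, (Set.range f \ {0}).encard ≤ k := by
  intro f hf
  by_contra hcon
  have hlt : ((k + 1 : ℕ) : ℕ∞) ≤ (Set.range f \ {0}).encard := by
    push_cast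
    exact Order.add_one_le_of_lt (not_le.mp hcon)
  obtain ⟨t, hts, htc⟩ := Set.exists_subset_encard_eq hlt
  have htfin : t.Finite := Set.finite_of_encard_eq_coe htc
  have hcard : htfin.toFinset.card = k + 1 := by
    rw [htfin.encard_eq_coe_toFinset_card] at htc
    exact_mod_cast htc
  let e := htfin.toFinset.equivFinOfCardEq hcard
  let v : Fin (k + 1) → ℝ := fun i => (e.symm i : ℝ)
  have hv : Function.Injective v := Subtype.val_injective.comp e.symm.injective
  have hvt : ∀ i, v i ∈ Set.range f \ {0} := fun i =>
    hts (htfin.mem_toFinset.mp (e.symm i).2)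
  have hpow : ∀ n : ℕ, f ^ (n + 1) ∈ L := by
    intro n
    induction n with
    | zero => simpa using hf
    | succ n ih => rw [pow_succ]; exact hmul _ ih _ hf
  have hli : LinearIndependent ℝ (fun i : Fin (k + 1) => (⟨f ^ ((i : ℕ) + 1), hpow i⟩ : L)) := by
    rw [Fintype.linearIndependent_iff]
    intro c hc
    have hc0 : c = 0 := by
      apply Matrix.eq_zero_of_forall_index_sum_mul_pow_eq_zero hv
      intro j
      obtain ⟨⟨x, hx⟩, hne⟩ := hvt j
      have h1 := congrFun (congrArg Subtype.val hc) x
      simp only [Submodule.coe_sum, Submodule.coe_smul, Finset.sum_apply, Pi.smul_apply,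
        Pi.pow_apply, hx, smul_eq_mul, Submodule.coe_zero, Pi.zero_apply] at h1
      have h2 : (∑ i, c i * v j ^ (i : ℕ)) * v j = 0 := by
        rw [← h1, Finset.sum_mul]
        exact Finset.sum_congr rfl fun i _ => by ring
      exact (mul_eq_zero.mp h2).resolve_right hne
    intro i
    rw [hc0]; rfl
  have := hli.fintype_card_le_finrank
  rw [hrank, Fintype.card_fin] at this
  omega
end
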